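/- There exists a finitely presented group Γ such that for every finitely presented group G one can find a finite-index subgroup Γ' of Γ with G isomorphic to the quotient Γ'/⟨Tor Γ'⟩, where ⟨Tor Γ'⟩ denotes the (normal) subgroup of Γ' generated by all elements of finite order. (This is the group-theoretic content of Theorem 1.3 of the paper; the paper moreover shows Γ can be taken hyperbolic.) -/

import Mathlib

/-- A group is finitely presented if it is isomorphic to a group presented by
finitely many generators and finitely many relations. -/
def IsFinitelyPresented (G : Type*) [Group G] : Prop :=
  ∃ (S : Type) (_ : Fintype S) (rels : Set (FreeGroup S)),
    rels.Finite ∧ Nonempty (G ≃* PresentedGroup rels)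

/-- The subgroup generated by the set of torsion elements is normal, since the set of
torsion elements is invariant under conjugation. -/
instance torsionClosure_normal {G : Type*} [Group G] :
    (Subgroup.closure {x : G | IsOfFinOrder x}).Normal := by
  constructor
  intro n hn g
  have key : ∀ x ∈ {x : G | IsOfFinOrder x},
      g * x * g⁻¹ ∈ Subgroup.closure {x : G | IsOfFinOrder x} := by
    intro x hx
    apply Subgroup.subset_closure
    exact (MulAut.conj g).toMonoidHom.isOfFinOrder hx
  induction hn using Subgroup.closure_induction with
  | mem x hx => exact key x hx
  | one => simpa using Subgroup.one_mem _
  | mul x y hx hy ihx ihy =>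
      have : g * (x * y) * g⁻¹ = (g * x * g⁻¹) * (g * y * g⁻¹) := by group
      rw [this]; exact Subgroup.mul_mem _ ihx ihy
  | inv x hx ih =>
      have : g * x⁻¹ * g⁻¹ = (g * x * g⁻¹)⁻¹ := by group
      rw [this]; exact Subgroup.inv_mem _ ih

namespace Monoid.PushoutI

/-- In an amalgamated product, every element of finite order is conjugate into a factor. -/
theorem exists_isConj_of_isOfFinOrder {ι : Type*} [Nonempty ι] {H : Type*} {G : ι → Type*}
    [∀ i, Group (G i)] [Group H] {φ : ∀ i, H →* G i}
    (hφ : ∀ i, Function.Injective (φ i)) {x : PushoutI φ} (hx : IsOfFinOrder x) :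
    ∃ (i : ι) (g : G i), IsConj (of (φ := φ) i g) x := by
  classical
  let val : (Σ i, G i) → PushoutI φ := fun s => of s.1 s.2
  let P : List (Σ i, G i) → Prop := fun l => IsConj (l.map val).prod x
  have hex : ∀ y : PushoutI φ, ∃ l : List (Σ i, G i), (l.map val).prod = y := by
    intro y
    induction y using PushoutI.induction_on with
    | of i g => exact ⟨[⟨i, g⟩], by simp [val]⟩
    | base h =>
      obtain ⟨i⟩ := ‹Nonempty ι›
      exact ⟨[⟨i, φ i h⟩], by simp [val, of_apply_eq_base]⟩
    | mul a b ha hb =>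
      obtain ⟨l, rfl⟩ := ha
      obtain ⟨m, rfl⟩ := hb
      exact ⟨l ++ m, by simp⟩
  have hP : ∃ n, ∃ l, l.length = n ∧ P l := by
    obtain ⟨l, hl⟩ := hex x
    exact ⟨_, l, rfl, by simp only [P, hl]; exact IsConj.refl x⟩
  obtain ⟨l, hlen, hl⟩ := Nat.find_spec hP
  have hmin : ∀ m, P m → l.length ≤ m.length := fun m hm => by
    rw [hlen]; exact Nat.find_min' hP ⟨m, rfl, hm⟩
  have hrot : ∀ s t, P (s ++ t) → P (t ++ s) := fun s t h => by
    refine IsConj.trans ?_ h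
    rw [isConj_iff]
    exact ⟨(s.map val).prod, by simp [mul_assoc]⟩
  match l, hlen, hl, hmin with
  | [], _, hl, _ =>
    obtain ⟨i⟩ := ‹Nonempty ι›
    exact ⟨i, 1, by simpa [P] using hl⟩
  | [a], _, hl, _ => exact ⟨a.1, a.2, by simpa [P, val] using hl⟩
  | c :: d :: r, _, hl, hmin =>
    set l := c :: d :: r with hldef
    have hpair : ∀ a b t, (a :: b :: t).length = l.length → P (a :: b :: t) → a.1 ≠ b.1 := by
      rintro ⟨i, a⟩ ⟨j, b⟩ t hlt hp (rfl : i = j)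
      have := hmin (⟨i, a * b⟩ :: t) (by simpa [P, val, mul_assoc] using hp)
      simp only [List.length_cons] at this hlt
      omega
    have hrange : ∀ a b t, (a :: b :: t).length = l.length → P (a :: b :: t) →
        a.2 ∉ (φ a.1).range := by
      rintro ⟨i, a⟩ ⟨j, b⟩ t hlt hp ⟨h, hh⟩
      have := hmin (⟨j, φ j h * b⟩ :: t) (by
        simp only [P, val, List.map_cons, List.prod_cons] at hp ⊢
        rw [← show φ i h = a from hh, of_apply_eq_base] at hp
        rwa [map_mul, of_apply_eq_base, mul_assoc])
      simp only [List.length_cons] at this hlt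
      omega
    have hmem : ∀ a ∈ l, a.2 ∉ (φ a.1).range := by
      intro a ha
      obtain ⟨s, t, hst⟩ := List.append_of_mem ha
      have h1 : P (a :: (t ++ s)) := hrot s (a :: t) (hst ▸ hl)
      have h2 : (a :: (t ++ s)).length = l.length := by
        rw [hst]; simp only [List.length_cons, List.length_append]; omega
      match hts : t ++ s with
      | [] => rw [hts] at h2; simp [hldef] at h2
      | b :: u => rw [hts] at h1 h2; exact hrange a b u h2 h1
    have hchain : l.IsChain fun u v => u.1 ≠ v.1 := by
      refine (List.isChain_isInfix l).imp ?_
      rintro a b ⟨s, t, hst⟩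
      have h1 : P (a :: b :: (t ++ s)) := by
        have := hrot s ([a, b] ++ t) (by rw [← List.append_assoc, hst]; exact hl)
        simpa using this
      refine hpair a b _ ?_ h1
      rw [← hst]; simp only [List.length_cons, List.length_append, List.length_nil]; omega
    have hends : ∀ z ∈ l.getLast?, z.1 ≠ c.1 := by
      intro z hz
      obtain ⟨s, hs⟩ := List.getLast?_eq_some_iff.1 hz
      have h1 : P (z :: s) := hrot s [z] (hs ▸ hl)
      have h2 : (z :: s).length = l.length := by rw [hs]; simp
      match s, hs, h1, h2 with
      | [], hs, _, _ => simp [hldef] at hs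
      | b :: u, hs, h1, h2 =>
        have : c = b := by simpa [hldef] using congrArg List.head? hs
        rw [this]
        exact hpair z b u h2 h1
    have hpow : ∀ k : ℕ, ((List.replicate k l).flatten).IsChain fun u v => u.1 ≠ v.1 := by
      intro k
      induction k with
      | zero => simp
      | succ k ih =>
        rw [List.replicate_succ, List.flatten_cons]
        refine hchain.append ih ?_
        intro z hz y hy
        cases k with
        | zero => simp at hy
        | succ k =>
          have : c = y := by simpa [List.replicate_succ, hldef] using hy
          exact this ▸ hends z hz
    obtain ⟨k, hk, hxk⟩ := isOfFinOrder_iff_pow_eq_one.1 hx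
    have hm : ∀ a ∈ (List.replicate k l).flatten, a.2 ∉ (φ a.1).range := by
      intro a ha
      obtain ⟨l', hl', ha'⟩ := List.mem_flatten.1 ha
      exact hmem a ((List.mem_replicate.1 hl').2 ▸ ha')
    let w : CoprodI.Word G := ⟨(List.replicate k l).flatten,
      fun a ha h1 => hm a ha (h1 ▸ one_mem _), hpow k⟩
    have hw : Reduced φ w := hm
    have hprod : ofCoprodI (φ := φ) w.prod = (l.map val).prod ^ k := by
      simp [w, CoprodI.Word.prod, map_list_prod, List.map_flatten, List.prod_flatten, val,
        Function.comp_def]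
    have hone : (l.map val).prod ^ k = 1 := by
      have := hl.pow k
      rw [hxk] at this
      simpa using this
    have := hw.eq_empty_of_mem_range hφ (by rw [hprod, hone]; exact one_mem _)
    have h3 := congrArg CoprodI.Word.toList this
    obtain ⟨k, rfl⟩ := Nat.exists_eq_succ_of_ne_zero hk.ne'
    simp [w, CoprodI.Word.empty, List.replicate_succ, hldef] at h3

end Monoid.PushoutI

open scoped commutatorElement in
/-- The relations of the right-angled Coxeter group on the vertex set `V` whose
commuting pairs are given by `r`. -/
def rightAngledRels {V : Type*} (r : V → V → Prop) : Set (FreeGroup V) :=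
  Set.range (fun x => FreeGroup.of x * FreeGroup.of x) ∪
    (fun p : V × V => ⁅FreeGroup.of p.1, FreeGroup.of p.2⁆) '' {p | r p.1 p.2}

/-- The right-angled Coxeter group: involutions indexed by `V`, two of which commute when
they are related by `r`. -/
abbrev RightAngled {V : Type*} (r : V → V → Prop) : Type _ :=
  PresentedGroup (rightAngledRels r)

namespace RightAngled

variable {V : Type*} {r : V → V → Prop}

/-- The generator of a right-angled Coxeter group attached to a vertex. -/
def gen (r : V → V → Prop) (x : V) : RightAngled r := PresentedGroup.of x

theorem gen_mul_self (x : V) : gen r x * gen r x = 1 :=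
  PresentedGroup.one_of_mem (rels := rightAngledRels r) (Or.inl ⟨x, rfl⟩)

theorem gen_inv (x : V) : (gen r x)⁻¹ = gen r x :=
  inv_eq_of_mul_eq_one_left (gen_mul_self x)

theorem gen_mul_gen_mul (x : V) (w : RightAngled r) : gen r x * (gen r x * w) = w := by
  rw [← mul_assoc, gen_mul_self, one_mul]

theorem isOfFinOrder_gen (x : V) : IsOfFinOrder (gen r x) :=
  isOfFinOrder_iff_pow_eq_one.2 ⟨2, two_pos, by rw [pow_two, gen_mul_self]⟩

theorem commute_gen {x y : V} (h : r x y) : Commute (gen r x) (gen r y) :=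
  commutatorElement_eq_one_iff_commute.1 <|
    PresentedGroup.one_of_mem (rels := rightAngledRels r) (Or.inr ⟨(x, y), h, rfl⟩)

theorem rels_eq_one {K : Type*} [Group K] {f : V → K} (hsq : ∀ x, f x * f x = 1)
    (hcomm : ∀ x y, r x y → f x * f y = f y * f x) :
    ∀ w ∈ rightAngledRels r, FreeGroup.lift f w = 1 := by
  rintro w (⟨x, rfl⟩ | ⟨⟨x, y⟩, h, rfl⟩)
  · simpa using hsq x
  · simpa [commutatorElement_eq_one_iff_mul_comm] using hcomm x y h

/-- The homomorphism out of a right-angled Coxeter group given by commuting involutions. -/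
def lift {K : Type*} [Group K] (f : V → K) (hsq : ∀ x, f x * f x = 1)
    (hcomm : ∀ x y, r x y → f x * f y = f y * f x) : RightAngled r →* K :=
  PresentedGroup.toGroup (rels_eq_one hsq hcomm)

@[simp]
theorem lift_gen {K : Type*} [Group K] (f : V → K) (hsq : ∀ x, f x * f x = 1)
    (hcomm : ∀ x y, r x y → f x * f y = f y * f x) (x : V) :
    lift f hsq hcomm (gen r x) = f x :=
  PresentedGroup.toGroup.of _

theorem closure_range_gen : Subgroup.closure (Set.range (gen r)) = ⊤ :=
  PresentedGroup.closure_range_of _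

/-- The subgroup generated by the involutions indexed by `U`. -/
def special (r : V → V → Prop) (U : Set V) : Subgroup (RightAngled r) :=
  Subgroup.closure (gen r '' U)

theorem gen_mem_special {U : Set V} {x : V} (hx : x ∈ U) : gen r x ∈ special r U :=
  Subgroup.subset_closure ⟨x, hx, rfl⟩

theorem special_mono {U U' : Set V} (h : U ⊆ U') : special r U ≤ special r U' :=
  Subgroup.closure_mono (Set.image_mono h)

/-- If `z true` and `z false` are vertices of `U` that do not commute, then every element of
finite order in the special subgroup on `U` is conjugate into the special subgroup obtained by
deleting one of these two vertices. -/
theorem exists_isConj_mem_special_diff {U : Set V} {z : Bool → V} (hz : z true ≠ z false)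
    (hr : ¬ r (z true) (z false)) (hr' : ¬ r (z false) (z true))
    {w : RightAngled r} (hw : w ∈ special r U) (hfin : IsOfFinOrder w) :
    ∃ i, ∃ g ∈ special r (U \ {z i}), IsConj g w := by
  classical
  obtain ⟨φ, hφval⟩ : ∃ φ : ∀ i : Bool, special r (U \ {z true, z false}) →*
      special r (U \ {z i}), ∀ i h, (φ i h : RightAngled r) = h :=
    ⟨fun i => Subgroup.inclusion
      (special_mono (Set.sdiff_subset_sdiff_right (by cases i <;> simp))), fun _ _ => rfl⟩
  have hφ : ∀ i, Function.Injective (φ i) := fun i a b hab =>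
    Subtype.ext (by rw [← hφval i a, ← hφval i b, hab])
  obtain ⟨Φ, hΦ⟩ : ∃ Φ : Monoid.PushoutI φ →* RightAngled r,
      ∀ i (g : special r (U \ {z i})), Φ (Monoid.PushoutI.of i g) = g := by
    have hc : ∀ i, (special r (U \ {z i})).subtype.comp (φ i) =
        (special r (U \ {z true, z false})).subtype := fun i => MonoidHom.ext (hφval i)
    exact ⟨Monoid.PushoutI.lift _ _ hc, fun i g => Monoid.PushoutI.lift_of _ _ hc g⟩
  obtain ⟨ofg, hofgdef⟩ : ∃ ofg : ∀ (i : Bool) (x : V), x ∈ U \ {z i} → Monoid.PushoutI φ,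
      ∀ i x hx, ofg i x hx = Monoid.PushoutI.of i ⟨gen r x, gen_mem_special hx⟩ :=
    ⟨_, fun _ _ _ => rfl⟩
  have hofg : ∀ (x : V) (i j : Bool) (hi : x ∈ U \ {z i}) (hj : x ∈ U \ {z j}),
      ofg i x hi = ofg j x hj := by
    intro x i j hi hj
    by_cases hij : i = j
    · subst hij; rfl
    have hx : x ∈ U \ {z true, z false} := by
      refine ⟨hi.1, ?_⟩
      have h1 := hi.2
      have h2 := hj.2
      cases i <;> cases j <;> simp_all
    have key : ∀ k (hk : x ∈ U \ {z k}),
        ofg k x hk = Monoid.PushoutI.base φ ⟨gen r x, gen_mem_special hx⟩ := fun k hk => by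
      rw [hofgdef, ← Monoid.PushoutI.of_apply_eq_base φ k]
      congr 1
      exact Subtype.ext (hφval k ⟨gen r x, gen_mem_special hx⟩).symm
    rw [key i hi, key j hj]
  obtain ⟨m, hm, hm1⟩ : ∃ m : V → Monoid.PushoutI φ,
      (∀ i x (hx : x ∈ U \ {z i}),
        m x = Monoid.PushoutI.of i ⟨gen r x, gen_mem_special hx⟩) ∧ ∀ x, x ∉ U → m x = 1 := by
    refine ⟨fun x => if h : ∃ i, x ∈ U \ {z i} then ofg h.choose x h.choose_spec else 1,
      fun i x hx => ?_, fun x hx => ?_⟩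
    · have h : ∃ i, x ∈ U \ {z i} := ⟨i, hx⟩
      simp only [dif_pos h]
      exact (hofg _ _ _ _ hx).trans (hofgdef i x hx)
    · have h : ¬ ∃ i, x ∈ U \ {z i} := fun ⟨i, hi⟩ => hx hi.1
      simp only [dif_neg h]
  have hdel : ∀ x ∈ U, ∃ i, x ∈ U \ {z i} := by
    intro x hx
    by_cases h : x = z true
    · exact ⟨false, hx, by simpa [h] using hz⟩
    · exact ⟨true, hx, h⟩
  have hsq : ∀ x, m x * m x = 1 := by
    intro x
    by_cases hx : x ∈ U
    · obtain ⟨i, hi⟩ := hdel x hx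
      rw [hm i x hi, ← map_mul, ← map_one (Monoid.PushoutI.of i)]
      congr 1
      exact Subtype.ext (gen_mul_self x)
    · rw [hm1 x hx, one_mul]
  have hcomm : ∀ x y, r x y → m x * m y = m y * m x := by
    intro x y hxy
    by_cases hx : x ∈ U
    swap
    · rw [hm1 x hx, one_mul, mul_one]
    by_cases hy : y ∈ U
    swap
    · rw [hm1 y hy, one_mul, mul_one]
    have : ∃ i, x ∈ U \ {z i} ∧ y ∈ U \ {z i} := by
      by_contra hcon
      push Not at hcon
      have h1 := hcon true
      have h2 := hcon false
      simp only [Set.mem_sdiff, Set.mem_singleton_iff, hx, hy, true_and, not_not] at h1 h2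
      by_cases hxt : x = z true
      · have := h2 (by rw [hxt]; exact hz)
        exact hr (hxt ▸ this ▸ hxy)
      · have := h1 hxt
        by_cases hxf : x = z false
        · exact hr' (hxf ▸ this ▸ hxy)
        · exact hz (this.symm.trans (h2 hxf))
    obtain ⟨i, hxi, hyi⟩ := this
    rw [hm i x hxi, hm i y hyi, ← map_mul, ← map_mul]
    congr 1
    exact Subtype.ext (commute_gen hxy)
  have hleft : ∀ p, lift m hsq hcomm (Φ p) = p := by
    intro p
    have : ((lift m hsq hcomm).comp Φ) = MonoidHom.id _ := by
      refine Monoid.PushoutI.hom_ext_nonempty fun i => ?_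
      ext ⟨g, hg⟩
      have : ∀ (g : RightAngled r) (hg : g ∈ special r (U \ {z i})),
          lift m hsq hcomm g = Monoid.PushoutI.of i ⟨g, hg⟩ := by
        intro g hg
        induction hg using Subgroup.closure_induction with
        | mem g hg =>
          obtain ⟨x, hx, rfl⟩ := hg
          rw [lift_gen, hm i x hx]
        | one => exact (map_one _).trans (map_one _).symm
        | mul a b ha hb iha ihb =>
          rw [map_mul, iha, ihb, ← map_mul]; rfl
        | inv a ha iha =>
          rw [map_inv, iha, ← map_inv]; rfl
      simpa [hΦ] using this g hg
    exact DFunLike.congr_fun this p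
  have hinj : Function.Injective Φ := Function.LeftInverse.injective hleft
  have hrange : special r U ≤ Φ.range := by
    refine (Subgroup.closure_le _).2 ?_
    rintro _ ⟨x, hx, rfl⟩
    obtain ⟨i, hi⟩ := hdel x hx
    exact ⟨Monoid.PushoutI.of i ⟨gen r x, gen_mem_special hi⟩, hΦ i _⟩
  obtain ⟨p, rfl⟩ := hrange hw
  obtain ⟨i, g, hg⟩ := Monoid.PushoutI.exists_isConj_of_isOfFinOrder hφ
    (hinj.isOfFinOrder_iff.1 hfin)
  refine ⟨i, g, g.2, ?_⟩
  simpa only [hΦ] using Φ.map_isConj hg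

/-- In a right-angled Coxeter group on finitely many generators, every element of finite order
is conjugate into the special subgroup of a clique. -/
theorem exists_isConj_mem_special_clique [Finite V] {w : RightAngled r}
    (hfin : IsOfFinOrder w) :
    ∃ T : Set V, (∀ x ∈ T, ∀ y ∈ T, x ≠ y → r x y ∨ r y x) ∧
      ∃ g ∈ special r T, IsConj g w := by
  have key : ∀ (n : ℕ) (U : Set V), U.ncard = n → ∀ w ∈ special r U, IsOfFinOrder w →
      ∃ T : Set V, (∀ x ∈ T, ∀ y ∈ T, x ≠ y → r x y ∨ r y x) ∧
        ∃ g ∈ special r T, IsConj g w := by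
    intro n
    induction n using Nat.strong_induction_on with
    | _ n ih =>
      intro U hU w hw hfin
      by_cases hcl : ∀ x ∈ U, ∀ y ∈ U, x ≠ y → r x y ∨ r y x
      · exact ⟨U, hcl, w, hw, IsConj.refl w⟩
      push Not at hcl
      obtain ⟨x, hx, y, hy, hxy, h1, h2⟩ := hcl
      obtain ⟨i, g, hg, hgw⟩ := exists_isConj_mem_special_diff (z := fun b => cond b x y)
        hxy h1 h2 hw hfin
      have hmem : cond i x y ∈ U := by cases i <;> assumption
      have hgfin : IsOfFinOrder g := by
        obtain ⟨c, hc⟩ := isConj_iff.1 hgw.symm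
        rw [← hc]
        exact (MulAut.conj c).toMonoidHom.isOfFinOrder hfin
      obtain ⟨T, hT, g', hg', hc⟩ := ih _
        (hU ▸ Set.ncard_sdiff_singleton_lt_of_mem hmem) _ rfl g hg hgfin
      exact ⟨T, hT, g', hg', hc.trans hgw⟩
  refine key _ Set.univ rfl w ?_ hfin
  rw [special, Set.image_univ, closure_range_gen]
  trivial

end RightAngled

/-- A finitely presented group `G` contains a finite family `ρ`, generating `G` and starting
with `1`, such that every map from the family to a group which respects the products that stay
within the family extends to a homomorphism. -/
theorem IsFinitelyPresented.exists_partialHom_extension {G : Type*} [Group G]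
    (hG : IsFinitelyPresented G) :
    ∃ (n : ℕ) (ρ : Fin (n + 1) → G), ρ 0 = 1 ∧ Subgroup.closure (Set.range ρ) = ⊤ ∧
      ∀ (H : Type) [Group H] (f : Fin (n + 1) → H),
        (∀ a b c, ρ a * ρ b = ρ c → f a * f b = f c) → ∃ ψ : G →* H, ∀ j, ψ (ρ j) = f j := by
  classical
  obtain ⟨S, _, rels, hrels, ⟨e⟩⟩ := hG
  let π : FreeGroup S →* G := e.symm.toMonoidHom.comp (PresentedGroup.mk rels)
  have hπe : ∀ w, e (π w) = PresentedGroup.mk rels w := fun w => e.apply_symm_apply _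
  let val : List (S × Bool) → G := fun w => π (FreeGroup.mk w)
  have hval : ∀ v w, val (v ++ w) = val v * val w := fun v w => by
    simp only [val, ← map_mul, FreeGroup.mul_mk]
  obtain ⟨N, hN⟩ := (hrels.image fun w => w.toWord.length).bddAbove
  have hN' : ∀ w ∈ rels, w.toWord.length ≤ N := fun w hw => hN ⟨w, hw, rfl⟩
  obtain ⟨n, ρ', -, hρ'⟩ := ((List.finite_length_le (S × Bool) (N + 1)).image val).fin_param
  let ρ : Fin (n + 1) → G := Fin.cons 1 ρ'
  have hval1 : val [] = 1 := by simp only [val, ← FreeGroup.one_eq_mk, map_one]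
  have hρ : ∀ w : List (S × Bool), w.length ≤ N + 1 → ∃ j, ρ j = val w := by
    intro w hw
    obtain ⟨j, hj⟩ : val w ∈ Set.range ρ' := hρ' ▸ ⟨w, hw, rfl⟩
    exact ⟨j.succ, by simpa [ρ] using hj⟩
  have hρinv : ∀ j, ∃ w : List (S × Bool), w.length ≤ N + 1 ∧ val w = ρ j := by
    intro j
    refine Fin.cases ⟨[], by simp, by simpa [ρ] using hval1⟩ (fun j => ?_) j
    obtain ⟨w, hw, hj⟩ : ρ' j ∈ val '' {l | l.length ≤ N + 1} := hρ' ▸ ⟨j, rfl⟩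
    exact ⟨w, hw, by simpa [ρ] using hj⟩
  refine ⟨n, ρ, rfl, ?_, ?_⟩
  · rw [eq_top_iff]
    intro g _
    obtain ⟨w, hw⟩ := PresentedGroup.mk_surjective rels (e g)
    have hg : g = π w := e.injective (by rw [hπe, hw])
    have hgen : ∀ s, π (FreeGroup.of s) ∈ Subgroup.closure (Set.range ρ) := fun s => by
      obtain ⟨j, hj⟩ := hρ [(s, true)] (by simp)
      exact Subgroup.subset_closure ⟨j, hj⟩
    have hall : ∀ w, π w ∈ Subgroup.closure (Set.range ρ) := fun w => by
      refine FreeGroup.induction_on (C := fun w => π w ∈ Subgroup.closure (Set.range ρ)) w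
        ?_ hgen (fun s h => ?_) fun a b ha hb => ?_
      · rw [map_one]; exact one_mem _
      · rw [map_inv]; exact inv_mem h
      · rw [map_mul]; exact mul_mem ha hb
    exact hg ▸ hall w
  · intro H _ f hf
    have hf0 : f 0 = 1 := by simpa using hf 0 0 0 (one_mul 1)
    have hfρ : ∀ a b, ρ a = ρ b → f a = f b := fun a b hab => by
      simpa [hf0] using hf a 0 b ((mul_one _).trans hab)
    let F : G → H := fun g => if h : ∃ j, ρ j = g then f h.choose else 1
    have hF : ∀ j, F (ρ j) = f j := by
      intro j
      have h : ∃ i, ρ i = ρ j := ⟨j, rfl⟩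
      simp only [F, dif_pos h]
      exact hfρ _ _ h.choose_spec
    have hFmul : ∀ v w : List (S × Bool), (v ++ w).length ≤ N + 1 →
        F (val (v ++ w)) = F (val v) * F (val w) := by
      intro v w hvw
      rw [List.length_append] at hvw
      obtain ⟨a, ha⟩ := hρ v (by omega)
      obtain ⟨b, hb⟩ := hρ w (by omega)
      obtain ⟨c, hc⟩ := hρ (v ++ w) (by rw [List.length_append]; omega)
      rw [← ha, ← hb, ← hc, hF, hF, hF]
      exact (hf a b c (by rw [ha, hb, hc, hval])).symm
    have hF1 : F 1 = 1 := by rw [show (1 : G) = ρ 0 from rfl, hF, hf0]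
    let θ : FreeGroup S →* H := FreeGroup.lift fun s => F (val [(s, true)])
    have hθ1 : ∀ s b, θ (FreeGroup.mk [(s, b)]) = F (val [(s, b)]) := by
      rintro s (_ | _)
      · have hinv : val [(s, false)] = (val [(s, true)])⁻¹ := by
          simp only [val, ← map_inv, FreeGroup.inv_mk]; rfl
        have hmul : F (val [(s, false)]) * F (val [(s, true)]) = 1 := by
          obtain ⟨a, ha⟩ := hρ [(s, false)] (by simp)
          obtain ⟨b, hb⟩ := hρ [(s, true)] (by simp)
          rw [← ha, ← hb, hF, hF, hf a b 0, hf0]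
          rw [ha, hb, hinv, inv_mul_cancel]; rfl
        rw [eq_inv_of_mul_eq_one_left hmul]
        simp [θ]
      · simp [θ]
    have hθ : ∀ w : List (S × Bool), w.length ≤ N + 1 → θ (FreeGroup.mk w) = F (val w) := by
      intro w
      induction w with
      | nil => intro _; rw [hval1, hF1, ← FreeGroup.one_eq_mk, map_one]
      | cons s w ih =>
        intro hw
        rw [← List.singleton_append, hFmul [s] w hw, ← FreeGroup.mul_mk, map_mul, hθ1,
          ih (by simp only [List.length_cons] at hw; omega)]
    have hker : ∀ w ∈ rels, θ w = 1 := by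
      intro w hw
      have h1 := hθ w.toWord ((hN' w hw).trans (Nat.le_succ N))
      have h2 : π w = 1 := by
        apply e.injective
        rw [hπe, map_one, PresentedGroup.one_of_mem hw]
      simp only [val, FreeGroup.mk_toWord] at h1
      rw [h1, h2, hF1]
    refine ⟨(PresentedGroup.toGroup (f := fun s => F (val [(s, true)])) hker).comp e.toMonoidHom,
      fun j => ?_⟩
    obtain ⟨w, hw, hj⟩ := hρinv j
    rw [← hF j, ← hj, ← hθ w hw]
    change PresentedGroup.toGroup hker (e (π _)) = _
    rw [hπe]
    rfl

namespace RightAngled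

variable {V : Type*} {r : V → V → Prop}

/-- Commuting involutions of `X`, together with `G`-valued functions `c` which on every clique
are the coboundary of a common potential, define an action of the right-angled Coxeter group on
`X` and a cocycle which vanishes on the elements of finite order fixing a point. -/
theorem exists_action_cocycle [Finite V] {X G : Type*} [Group G] {σ : V → X → X} {c : V → X → G}
    (hσ : ∀ s x, σ s (σ s x) = x)
    (hcomm : ∀ s s', r s s' → ∀ x, σ s (σ s' x) = σ s' (σ s x))
    (hc : ∀ T : Set V, (∀ s ∈ T, ∀ s' ∈ T, s ≠ s' → r s s' ∨ r s' s) →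
      ∃ f : X → G, ∀ s ∈ T, ∀ x, c s x = f (σ s x) * (f x)⁻¹) :
    ∃ (act : RightAngled r →* Equiv.Perm X) (κ : RightAngled r → X → G),
      (∀ s x, act (gen r s) x = σ s x) ∧ (∀ s x, κ (gen r s) x = c s x) ∧
      (∀ w w' x, κ (w * w') x = κ w (act w' x) * κ w' x) ∧
      ∀ w x, IsOfFinOrder w → act w x = x → κ w x = 1 := by
  have hsq : ∀ s x, c s (σ s x) * c s x = 1 := by
    intro s x
    obtain ⟨f, hf⟩ := hc {s} (by simp)
    simp [hf s rfl, hσ]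
  have hcc : ∀ s s', r s s' → ∀ x, c s (σ s' x) * c s' x = c s' (σ s x) * c s x := by
    intro s s' h x
    obtain ⟨f, hf⟩ := hc {s, s'} (by
      rintro x (rfl | rfl) y (rfl | rfl) hxy <;> simp_all)
    simp [hf s (by simp), hf s' (by simp), hcomm s s' h]
  obtain ⟨act, hact⟩ : ∃ act : RightAngled r →* Equiv.Perm X,
      ∀ s x, act (gen r s) x = σ s x := by
    refine ⟨lift (fun s => ⟨σ s, σ s, hσ s, hσ s⟩) (fun s => ?_) (fun s s' h => ?_), ?_⟩
    · ext x; exact hσ s x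
    · ext x; exact hcomm s s' h x
    · intro s x; rw [lift_gen]; rfl
  obtain ⟨A, hA⟩ : ∃ A : RightAngled r →* Equiv.Perm (X × G),
      ∀ s x g, A (gen r s) (x, g) = (σ s x, c s x * g) := by
    have hinv : ∀ s, Function.Involutive fun y : X × G => (σ s y.1, c s y.1 * y.2) := by
      rintro s ⟨x, g⟩
      simp [hσ, ← mul_assoc, hsq]
    refine ⟨lift (fun s => (hinv s).toPerm) (fun s => ?_) (fun s s' h => ?_), ?_⟩
    · ext1 y; exact hinv s y
    · ext1 ⟨x, g⟩
      simp [hcomm s s' h, ← mul_assoc, hcc s s' h]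
    · intro s x g; rw [lift_gen]; rfl
  have hAκ : ∀ w x g, A w (x, g) = (act w x, (A w (x, 1)).2 * g) := by
    intro w
    have hw : w ∈ Subgroup.closure (Set.range (gen r)) := by
      rw [closure_range_gen]; trivial
    induction hw using Subgroup.closure_induction_left with
    | one => simp
    | mul_left s hs w hw ih =>
      obtain ⟨s, rfl⟩ := hs
      intro x g
      simp only [map_mul, Equiv.Perm.mul_apply]
      rw [ih x g, ih x 1, hA, hA, hact]
      simp [mul_assoc]
    | inv_mul_cancel s hs w hw ih =>
      obtain ⟨s, rfl⟩ := hs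
      intro x g
      simp only [gen_inv, map_mul, Equiv.Perm.mul_apply]
      rw [ih x g, ih x 1, hA, hA, hact]
      simp [mul_assoc]
  have hκmul : ∀ w w' x, (A (w * w') (x, 1)).2 = (A w (act w' x, 1)).2 * (A w' (x, 1)).2 := by
    intro w w' x
    rw [map_mul, Equiv.Perm.mul_apply, hAκ w' x 1, hAκ w _ _]
  have hκgen : ∀ s x, (A (gen r s) (x, 1)).2 = c s x := fun s x => by rw [hA, mul_one]
  refine ⟨act, fun w x => (A w (x, 1)).2, hact, hκgen, hκmul, ?_⟩
  intro w x hw hx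
  obtain ⟨κ, hκ⟩ : ∃ κ : RightAngled r → X → G, ∀ w x, κ w x = (A w (x, 1)).2 :=
    ⟨_, fun _ _ => rfl⟩
  simp only [← hκ] at hκmul hκgen ⊢
  have hκ1 : ∀ x, κ 1 x = 1 := fun x => by simp [hκ]
  obtain ⟨T, hT, g, hg, hgw⟩ := exists_isConj_mem_special_clique hw
  obtain ⟨f, hf⟩ := hc T hT
  have hgf : ∀ g ∈ special r T, ∀ x, κ g x = f (act g x) * (f x)⁻¹ := by
    intro g hg
    induction hg using Subgroup.closure_induction_left with
    | one => simp [hκ1]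
    | mul_left s hs w hw ih =>
      obtain ⟨s, hs, rfl⟩ := hs
      intro x
      simp [hκmul, ih, hκgen, hf s hs, hact]
    | inv_mul_cancel s hs w hw ih =>
      obtain ⟨s, hs, rfl⟩ := hs
      intro x
      simp [gen_inv, hκmul, ih, hκgen, hf s hs, hact]
  obtain ⟨u, rfl⟩ := isConj_iff.1 hgw
  have hfix : act g (act u⁻¹ x) = act u⁻¹ x := by
    rw [map_inv, Equiv.Perm.eq_inv_iff_eq, ← map_inv]
    simpa using hx
  rw [hκmul, hκmul, hgf g hg, hfix, mul_inv_cancel, mul_one, ← hκmul, mul_inv_cancel, hκ1]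

end RightAngled

/-- A criterion for a group `G` to be the quotient of a point stabilizer by its torsion: there is
a `G`-valued cocycle that vanishes on elements of finite order, is normalized by a transversal
`θ`, takes enough values, and is universal for these properties. -/
theorem exists_finiteIndex_mulEquiv_of_cocycle {Γ X G : Type} [Group Γ] [Group G] [Finite X]
    {S : Set Γ} (hS : Subgroup.closure S = ⊤) (hSinv : ∀ s ∈ S, s⁻¹ = s)
    (act : Γ →* Equiv.Perm X) (x₀ : X)
    (κ : Γ → X → G) (hκ : ∀ w w' x, κ (w * w') x = κ w (act w' x) * κ w' x)
    (hκtor : ∀ w x, IsOfFinOrder w → act w x = x → κ w x = 1)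
    (θ : X → Γ) (hθ₀ : θ x₀ = 1) (hθ : ∀ x, act (θ x) x₀ = x) (hκθ : ∀ x, κ (θ x) x₀ = 1)
    (hgen : Subgroup.closure {g | ∃ s x, κ s x = g} = ⊤)
    (huniv : ∀ (Q : Type) [Group Q] (E : Γ → X → Q),
      (∀ w w' x, E (w * w') x = E w (act w' x) * E w' x) →
      (∀ w x, IsOfFinOrder w → act w x = x → E w x = 1) → (∀ x, E (θ x) x₀ = 1) →
      ∃ ψ : G →* Q, ∀ s ∈ S, ∀ x, E s x = ψ (κ s x)) :
    ∃ Γ' : Subgroup Γ, Γ'.FiniteIndex ∧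
      Nonempty (G ≃* (Γ' ⧸ Subgroup.closure {x : Γ' | IsOfFinOrder x})) := by
  obtain ⟨Γ', hΓ'⟩ : ∃ Γ' : Subgroup Γ, Γ' = (MulAction.stabilizer (Equiv.Perm X) x₀).comap act :=
    ⟨_, rfl⟩
  have hmem : ∀ w, w ∈ Γ' ↔ act w x₀ = x₀ := fun w => by
    rw [hΓ']; rfl
  have hfin : Γ'.FiniteIndex := by
    refine Subgroup.finiteIndex_of_le (H := act.ker) fun w hw => (hmem w).2 ?_
    rw [MonoidHom.mem_ker.1 hw, Equiv.Perm.one_apply]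
  refine ⟨Γ', hfin, ?_⟩
  have h1 : ∀ x, κ 1 x = 1 := fun x => by simpa using hκ 1 1 x
  let φ : Γ' →* G :=
    { toFun := fun w => κ w x₀
      map_one' := h1 x₀
      map_mul' := fun w w' => by
        rw [Subgroup.coe_mul, hκ, (hmem _).1 w'.2] }
  have hloop : ∀ w x, (θ (act w x))⁻¹ * w * θ x ∈ Γ' := fun w x => by
    rw [hmem]
    simp only [map_mul, map_inv, Equiv.Perm.mul_apply, hθ]
    rw [Equiv.Perm.inv_eq_iff_eq, hθ]
  have hκinv : ∀ x, κ (θ x)⁻¹ x = 1 := fun x => by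
    have := hκ (θ x)⁻¹ (θ x) x₀
    rwa [inv_mul_cancel, h1, hθ, hκθ, mul_one, eq_comm] at this
  have hφloop : ∀ w x, φ ⟨_, hloop w x⟩ = κ w x := fun w x => by
    change κ _ x₀ = _
    rw [hκ, hκ, hθ, hκinv, hκθ, one_mul, mul_one]
  have hsurj : Function.Surjective φ := by
    rw [← MonoidHom.range_eq_top, eq_top_iff, ← hgen, Subgroup.closure_le]
    rintro _ ⟨w, x, rfl⟩
    exact ⟨_, hφloop w x⟩
  let N := Subgroup.closure {x : Γ' | IsOfFinOrder x}
  let E : Γ → X → Γ' ⧸ N := fun w x => QuotientGroup.mk ⟨_, hloop w x⟩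
  have hker : φ.ker = N := by
    apply le_antisymm
    · have hEmul : ∀ w w' x, E (w * w') x = E w (act w' x) * E w' x := fun w w' x => by
        simp only [E, ← QuotientGroup.mk_mul]
        congr 1
        ext
        simp [mul_assoc]
      have hE1 : ∀ x, E 1 x = 1 := fun x => by simpa using hEmul 1 1 x
      obtain ⟨ψ, hψ⟩ := huniv (Γ' ⧸ N) E hEmul
        (fun w x hw hx => by
          rw [QuotientGroup.eq_one_iff]
          apply Subgroup.subset_closure
          refine Γ'.subtype_injective.isOfFinOrder_iff.1 ?_
          simpa [hx] using (MulAut.conj (θ x)⁻¹).toMonoidHom.isOfFinOrder hw)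
        (fun x => by
          rw [QuotientGroup.eq_one_iff]
          convert one_mem N
          simp [hθ, hθ₀])
      have hE : ∀ w x, E w x = ψ (κ w x) := by
        intro w
        have hw : w ∈ Subgroup.closure S := hS ▸ Subgroup.mem_top w
        induction hw using Subgroup.closure_induction_left with
        | one => intro x; rw [hE1, h1, map_one]
        | mul_left s hs w hw ih => intro x; rw [hEmul, hκ, map_mul, ih, hψ s hs]
        | inv_mul_cancel s hs w hw ih =>
          intro x; rw [hSinv s hs, hEmul, hκ, map_mul, ih, hψ s hs]
      intro w hw
      have hw1 : E w x₀ = 1 := by rw [hE, show κ w x₀ = 1 from hw, map_one]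
      rw [QuotientGroup.eq_one_iff] at hw1
      simpa [hθ₀, (hmem _).1 w.2] using hw1
    · rw [Subgroup.closure_le]
      intro w hw
      exact hκtor _ _ (Γ'.subtype.isOfFinOrder hw) ((hmem _).1 w.2)
  exact ⟨(QuotientGroup.quotientKerEquivOfSurjective φ hsurj).symm.trans
    (QuotientGroup.quotientMulEquivOfEq hker)⟩

/-- A rooted path whose edges are alternately swapped by two involutions: every vertex comes
with a word in the involutions that leads to it from the root. -/
structure Zigzag (J : Type*) where
  /-- The two involutions. -/
  move : Bool → J → J
  move_move : ∀ e j, move e (move e j) = j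
  /-- The base vertex. -/
  root : J
  /-- A word leading from the root to a given vertex. -/
  word : J → List Bool
  word_root : word root = []
  foldr_word : ∀ j, (word j).foldr move root = j
  move_cases : ∀ e j, move e j = j ∨ word (move e j) = e :: word j ∨ word j = e :: word (move e j)

namespace Zigzag

theorem eq_root {J α : Type*} (A : Zigzag J) (g : J → α) (hg : ∀ e j, g (A.move e j) = g j)
    (j : J) : g j = g A.root := by
  rw [← A.foldr_word j]
  induction A.word j with
  | nil => rfl
  | cons e w ih => rw [List.foldr_cons, hg, ih]

/-- The word `[…, true, false]` of length `k`, leading from `0` to `k`. -/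
def natWord : ℕ → List Bool
  | 0 => []
  | k + 1 => k.bodd :: natWord k

/-- The involution of `{0, …, n}` swapping `k` and `k + 1` whenever `k < n` has parity `e`. -/
def finMove (n : ℕ) (e : Bool) (j : Fin (n + 1)) : Fin (n + 1) :=
  if (j : ℕ).bodd = e then if h : (j : ℕ) + 1 < n + 1 then ⟨j + 1, h⟩ else j
  else ⟨j - 1, by omega⟩

theorem finMove_cases (n : ℕ) (e : Bool) (j : Fin (n + 1)) :
    (finMove n e j = j) ∨
      ((finMove n e j : ℕ) = j + 1 ∧ (j : ℕ).bodd = e) ∨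
      ((j : ℕ) = finMove n e j + 1 ∧ (finMove n e j : ℕ).bodd = e) := by
  obtain ⟨j, hj⟩ := j
  unfold finMove
  split_ifs with h1 h2
  · exact Or.inr (Or.inl ⟨rfl, h1⟩)
  · exact Or.inl rfl
  · cases j with
    | zero => exact Or.inl rfl
    | succ k =>
      refine Or.inr (Or.inr ⟨rfl, ?_⟩)
      simp only [Nat.bodd_succ, Nat.add_sub_cancel] at h1 ⊢
      cases h : k.bodd <;> cases e <;> simp_all

theorem finMove_of_eq_succ {n : ℕ} {e : Bool} {j k : Fin (n + 1)} (hk : (k : ℕ) = j + 1)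
    (he : (j : ℕ).bodd = e) : finMove n e j = k ∧ finMove n e k = j := by
  constructor
  · have hlt : (j : ℕ) + 1 < n + 1 := hk ▸ k.2
    ext
    simp [finMove, he, hlt, hk]
  · ext
    simp [finMove, hk, ← he]

/-- The path on `{0, …, n}` rooted at `0`. -/
def fin (n : ℕ) : Zigzag (Fin (n + 1)) where
  move := finMove n
  move_move e j := by
    rcases finMove_cases n e j with h | ⟨h, he⟩ | ⟨h, he⟩
    · rw [h, h]
    · exact (finMove_of_eq_succ h he).2
    · exact (finMove_of_eq_succ h he).1
  root := 0
  word j := natWord j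
  word_root := rfl
  foldr_word := by
    rintro ⟨j, hj⟩
    induction j with
    | zero => rfl
    | succ k ih =>
      change finMove n k.bodd ((natWord k).foldr (finMove n) 0) = _
      have hk := ih (by omega)
      dsimp only at hk
      rw [hk]
      exact (finMove_of_eq_succ rfl rfl).1
  move_cases e j := by
    rcases finMove_cases n e j with h | ⟨h, he⟩ | ⟨h, he⟩
    · exact Or.inl h
    · exact Or.inr (Or.inl (by rw [h, natWord, he]))
    · exact Or.inr (Or.inr (by rw [h, natWord, he]))

end Zigzag

/-- The generators of the all-inclusive group. -/
inductive Generator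
  | a (e : Bool)
  | b (e : Bool)
  | p (d : Bool)
  | v (d e : Bool)
  | t (d e : Bool)

namespace Generator

instance : Finite Generator := by
  refine Finite.of_surjective
    (fun x : (Bool ⊕ Bool ⊕ Bool) ⊕ (Bool × Bool) ⊕ (Bool × Bool) =>
      x.elim (Sum.elim a (Sum.elim b p)) (Sum.elim (fun y => v y.1 y.2) fun y => t y.1 y.2)) ?_
  rintro (e | e | d | ⟨d, e⟩ | ⟨d, e⟩)
  · exact ⟨.inl (.inl e), rfl⟩
  · exact ⟨.inl (.inr (.inl e)), rfl⟩
  · exact ⟨.inl (.inr (.inr d)), rfl⟩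
  · exact ⟨.inr (.inl (d, e)), rfl⟩
  · exact ⟨.inr (.inr (d, e)), rfl⟩

/-- The commuting pairs of generators. -/
inductive Comm : Generator → Generator → Prop
  | ab (e e' : Bool) : Comm (a e) (b e')
  | ap (e d : Bool) : Comm (a e) (p d)
  | bv (e d e' : Bool) : Comm (b e) (v d e')
  | pp : Comm (p false) (p true)
  | pt (d e : Bool) : Comm (p d) (t d e)
  | tv (d e : Bool) : Comm (t d e) (v d e)

/-- The `d`-th coordinate of a corner of the unit square. -/
def coord (d : Bool) (l : Bool × Bool) : Bool := cond d l.2 l.1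

/-- Reflect the `d`-th coordinate of a corner of the unit square. -/
def reflect (d : Bool) (l : Bool × Bool) : Bool × Bool := cond d (l.1, !l.2) (!l.1, l.2)

@[simp]
theorem reflect_reflect (d : Bool) (l : Bool × Bool) : reflect d (reflect d l) = l := by
  cases d <;> simp [reflect]

@[simp]
theorem coord_reflect (d : Bool) (l : Bool × Bool) : coord d (reflect d l) = !coord d l := by
  cases d <;> simp [reflect, coord]

@[simp]
theorem coord_not_reflect (d : Bool) (l : Bool × Bool) : coord (!d) (reflect d l) = coord (!d) l := by
  cases d <;> simp [reflect, coord]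

theorem reflect_comm (d d' : Bool) (l : Bool × Bool) : reflect d (reflect d' l) = reflect d' (reflect d l) := by
  cases d <;> cases d' <;> rfl

variable {I J G : Type*} [Group G] (A : Zigzag J) (B : Zigzag I) (ρ : J → G)
  (R : I → Bool → Bool → J)

open Classical in
/-- The action of the generators on `(corner of the square) × I × J`, where `I` indexes
labellings of the edges of the square by `J`: `a` and `b` walk along `J` and `I`, `p d` reflects
the square, `v d e` moves along the edge `(d, e)`, and `t d e` does so only if the label of that
edge is the current one. -/
noncomputable def move : Generator → (Bool × Bool) × I × J → (Bool × Bool) × I × J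
  | a e, x => (x.1, x.2.1, A.move e x.2.2)
  | b e, x => (x.1, B.move e x.2.1, x.2.2)
  | p d, x => (reflect d x.1, x.2)
  | v d e, x => if coord (!d) x.1 = e then (reflect d x.1, x.2) else x
  | t d e, x => if coord (!d) x.1 = e ∧ R x.2.1 d e = x.2.2 then (reflect d x.1, x.2) else x

/-- The potential on the corners of a square with edges labelled by `S`. -/
def cornerPot (S : Bool → Bool → J) (l : Bool × Bool) : G :=
  cond l.2 (ρ (S true l.1)) 1 * cond l.1 (ρ (S false false)) 1

/-- The potential whose coboundary on a generator is the cocycle. -/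
def pot : Generator → (Bool × Bool) × I × J → G
  | a _, _ => 1
  | b _, _ => 1
  | p _, x => cornerPot ρ (R x.2.1) x.1
  | v d _, x => cond (coord d x.1) (ρ x.2.2) 1
  | t _ _, x => cornerPot ρ (R x.2.1) x.1

/-- The value of the cocycle on a generator. -/
noncomputable def cocycle (s : Generator) (x : (Bool × Bool) × I × J) : G :=
  pot ρ R s (move A B R s x) * (pot ρ R s x)⁻¹

theorem move_move (s : Generator) (x : (Bool × Bool) × I × J) :
    move A B R s (move A B R s x) = x := by
  obtain ⟨l, i, j⟩ := x
  cases s with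
  | a e => simp [move, A.move_move]
  | b e => simp [move, B.move_move]
  | p d => simp [move]
  | v d e =>
    by_cases h : coord (!d) l = e <;> simp [move, h]
  | t d e =>
    by_cases h : coord (!d) l = e ∧ R i d e = j <;> simp [move, h]

theorem move_comm {s s' : Generator} (h : Comm s s') (x : (Bool × Bool) × I × J) :
    move A B R s (move A B R s' x) = move A B R s' (move A B R s x) := by
  obtain ⟨l, i, j⟩ := x
  cases h with
  | ab e e' => rfl
  | ap e d => rfl
  | bv e d e' => by_cases h : coord (!d) l = e' <;> simp [move, h]
  | pp => simp [move, reflect_comm false true]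
  | pt d e => by_cases h : coord (!d) l = e ∧ R i d e = j <;> simp [move, h]
  | tv d e =>
    by_cases h : coord (!d) l = e <;> by_cases h' : R i d e = j <;> simp [move, h, h']

theorem cornerPot_reflect {S : Bool → Bool → J}
    (hS : ρ (S true true) * ρ (S false false) = ρ (S false true) * ρ (S true false))
    {d : Bool} {l : Bool × Bool} (hl : coord d l = false) :
    cornerPot ρ S (reflect d l) = ρ (S d (coord (!d) l)) * cornerPot ρ S l := by
  rcases l with ⟨_ | _, _ | _⟩ <;> cases d <;> simp_all [coord, reflect, cornerPot]

theorem cocycle_move (s : Generator) (x : (Bool × Bool) × I × J) :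
    cocycle A B ρ R s (move A B R s x) * cocycle A B ρ R s x = 1 := by
  simp [cocycle, move_move]

/-- On a commuting pair `t d e`, `v d e` the two potentials have the same coboundary. -/
theorem cocycle_t
    (hR : ∀ i, ρ (R i true true) * ρ (R i false false) = ρ (R i false true) * ρ (R i true false))
    (d e : Bool) (x : (Bool × Bool) × I × J) :
    cocycle A B ρ R (t d e) x =
      pot ρ R (v d e) (move A B R (t d e) x) * (pot ρ R (v d e) x)⁻¹ := by
  obtain ⟨l, i, j⟩ := x
  by_cases h : coord (!d) l = e ∧ R i d e = j
  · obtain ⟨rfl, rfl⟩ := h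
    cases hl : coord d l with
    | false => simp [cocycle, move, pot, hl, cornerPot_reflect ρ (hR i) hl]
    | true =>
      have h := cornerPot_reflect ρ (hR i) (d := d) (l := reflect d l) (by simp [hl])
      rw [reflect_reflect, coord_not_reflect] at h
      simp [cocycle, move, pot, hl, h]
  · simp [cocycle, move, h]

theorem exists_pot_of_clique
    (hR : ∀ i, ρ (R i true true) * ρ (R i false false) = ρ (R i false true) * ρ (R i true false))
    (T : Set Generator) (hT : ∀ s ∈ T, ∀ s' ∈ T, s ≠ s' → Comm s s' ∨ Comm s' s) :
    ∃ f : (Bool × Bool) × I × J → G, ∀ s ∈ T, ∀ x,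
      cocycle A B ρ R s x = f (move A B R s x) * (f x)⁻¹ := by
  by_cases hv : ∃ d e, v d e ∈ T
  · obtain ⟨d, e, hv⟩ := hv
    refine ⟨pot ρ R (v d e), fun s hs x => ?_⟩
    by_cases hsv : s = v d e
    · rw [hsv]; rfl
    rcases hT s hs _ hv hsv with h | h
    · cases h with
      | bv e' => simp [cocycle, move, pot]
      | tv => exact cocycle_t A B ρ R hR d e x
    · nomatch h
  by_cases hp : ∃ d, p d ∈ T ∨ ∃ e, t d e ∈ T
  · refine ⟨pot ρ R (p true), fun s hs x => ?_⟩
    cases s with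
    | a e => simp [cocycle, move, pot]
    | b e =>
      obtain ⟨d, hp | ⟨e', ht⟩⟩ := hp
      · rcases hT _ hs _ hp nofun with h | h <;> nomatch h
      · rcases hT _ hs _ ht nofun with h | h <;> nomatch h
    | p d => rfl
    | v d e => exact (hv ⟨d, e, hs⟩).elim
    | t d e => rfl
  refine ⟨1, fun s hs x => ?_⟩
  cases s with
  | a e => simp [cocycle, pot]
  | b e => simp [cocycle, pot]
  | p d => exact (hp ⟨d, .inl hs⟩).elim
  | v d e => exact (hv ⟨d, e, hs⟩).elim
  | t d e => exact (hp ⟨d, .inr ⟨e, hs⟩⟩).elim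

end Generator

namespace Generator

variable {I J G : Type*} [Group G] (A : Zigzag J) (B : Zigzag I) (ρ : J → G)
  (R : I → Bool → Bool → J)

/-- The cocycle is universal: any other cocycle satisfying the same normalizations is obtained
from it by a homomorphism. -/
theorem exists_hom_eq_cocycle {Q : Type*} [Group Q] (hρ : ρ A.root = 1)
    (hext : ∀ f : J → Q, (∀ a b c, ρ a * ρ b = ρ c → f a * f b = f c) →
      ∃ ψ : G →* Q, ∀ j, ψ (ρ j) = f j)
    (hR : ∀ i, ρ (R i true true) * ρ (R i false false) = ρ (R i false true) * ρ (R i true false))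
    (hRsurj : ∀ S : Bool → Bool → J,
      ρ (S true true) * ρ (S false false) = ρ (S false true) * ρ (S true false) → ∃ i, R i = S)
    (E : Generator → (Bool × Bool) × I × J → Q)
    (hinv : ∀ s x, E s (move A B R s x) * E s x = 1)
    (hcomm : ∀ s s', Comm s s' → ∀ x,
      E s (move A B R s' x) * E s' x = E s' (move A B R s x) * E s x)
    (hfix : ∀ s x, move A B R s x = x → E s x = 1)
    (htor : ∀ s s', Comm s s' → ∀ x, move A B R s x = move A B R s' x → E s x = E s' x)
    (ha : ∀ e x, E (a e) x = 1) (hb : ∀ e x, E (b e) x = 1)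
    (h00 : E (v false false) ((false, false), B.root, A.root) = 1)
    (h10 : E (v true false) ((false, false), B.root, A.root) = 1)
    (h11 : E (v true true) ((true, false), B.root, A.root) = 1) :
    ∃ ψ : G →* Q, ∀ s x, E s x = ψ (cocycle A B ρ R s x) := by
  have hpj : ∀ d l i j, E (p d) (l, i, j) = E (p d) (l, i, A.root) := fun d l i j =>
    A.eq_root (fun j => E (p d) (l, i, j))
      (fun e j => by simpa [ha, move] using (hcomm _ _ (.ap e d) (l, i, j)).symm) j
  have hvi : ∀ d e l i j, E (v d e) (l, i, j) = E (v d e) (l, B.root, j) := fun d e l i j =>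
    B.eq_root (fun i => E (v d e) (l, i, j))
      (fun e' i => by simpa [hb, move] using (hcomm _ _ (.bv e' d e) (l, i, j)).symm) i
  obtain ⟨f, hf⟩ : ∃ f : Bool → Bool → J → Q, ∀ d l i j, coord d l = false →
      E (v d (coord (!d) l)) (l, i, j) = f d (coord (!d) l) j := by
    refine ⟨fun d e j => E (v d e) (cond d (e, false) (false, e), B.root, j), fun d l i j hl => ?_⟩
    rw [hvi]
    rcases l with ⟨_ | _, _ | _⟩ <;> cases d <;> first | rfl | cases hl
  have hp : ∀ d l i j, coord d l = false →
      E (p d) (l, i, j) = f d (coord (!d) l) (R i d (coord (!d) l)) := by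
    intro d l i j hl
    obtain ⟨e, he⟩ : ∃ e, coord (!d) l = e := ⟨_, rfl⟩
    have hfe := hf d l i (R i d e) hl
    rw [he] at hfe ⊢
    have ht : move A B R (t d e) (l, i, R i d e) = (reflect d l, i, R i d e) := by
      simp [move, he]
    have hv : move A B R (v d e) (l, i, R i d e) = (reflect d l, i, R i d e) := by
      simp [move, he]
    rw [hpj d l i j, ← hpj d l i (R i d e), ← hfe, ← htor _ _ (.tv d e) _ (ht.trans hv.symm)]
    exact htor _ _ (.pt d e) _ ht.symm
  have hrow : ∀ i, f true true (R i true true) * f false false (R i false false) =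
      f false true (R i false true) * f true false (R i true false) := by
    intro i
    have h := hcomm _ _ .pp ((false, false), i, A.root)
    simp only [move] at h
    rw [hp _ _ _ _ rfl, hp _ _ _ _ rfl, hp _ _ _ _ rfl, hp _ _ _ _ rfl] at h
    exact h.symm
  have hrow' : ∀ x y z w, ρ x * ρ y = ρ z * ρ w →
      f true true x * f false false y = f false true z * f true false w := by
    intro x y z w h
    obtain ⟨i, hi⟩ := hRsurj (fun d e => cond d (cond e x w) (cond e z y)) h
    simpa [hi] using hrow i
  have f00 : f false false A.root = 1 := (hf false (false, false) _ _ rfl).symm.trans h00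
  have f10 : f true false A.root = 1 := (hf true (false, false) _ _ rfl).symm.trans h10
  have f11 : f true true A.root = 1 := (hf true (true, false) _ _ rfl).symm.trans h11
  have f01 : f false true A.root = 1 := by
    simpa [f00, f10, f11] using (hrow' A.root A.root A.root A.root rfl).symm
  have e10 : ∀ j, f true false j = f false false j := fun j => by
    simpa [f11, f01] using (hrow' A.root j A.root j rfl).symm
  have e11 : ∀ j, f true true j = f false false j := fun j => by
    simpa [f00, f01, e10] using hrow' j A.root A.root j (by simp [hρ])
  have e01 : ∀ j, f false true j = f false false j := fun j => by
    simpa [f00, f10, e11] using (hrow' j A.root j A.root rfl).symm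
  have hfj : ∀ d e j, f d e j = f false false j := by
    rintro (_ | _) (_ | _) j
    exacts [rfl, e01 j, e10 j, e11 j]
  obtain ⟨ψ, hψ⟩ := hext (f false false) fun x y z h => by
    have := hrow' x y z A.root (by rw [h, hρ, mul_one])
    rwa [hfj, hfj false true, f10, mul_one] at this
  have hψf : ∀ d e j, f d e j = ψ (ρ j) := fun d e j => by rw [hfj, hψ]
  have hback : ∀ s x, E s (move A B R s x) = ψ (cocycle A B ρ R s (move A B R s x)) →
      E s x = ψ (cocycle A B ρ R s x) := by
    intro s x h
    rw [eq_inv_of_mul_eq_one_right (hinv s x), h, ← map_inv,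
      ← eq_inv_of_mul_eq_one_right (cocycle_move A B ρ R s x)]
  have hEp : ∀ d x, E (p d) x = ψ (cocycle A B ρ R (p d) x) := by
    have key : ∀ d l i j, coord d l = false →
        E (p d) (l, i, j) = ψ (cocycle A B ρ R (p d) (l, i, j)) := by
      intro d l i j hl
      rw [hp d l i j hl, hψf]
      simp [cocycle, move, pot, cornerPot_reflect ρ (hR i) hl]
    rintro d ⟨l, i, j⟩
    cases hl : coord d l with
    | false => exact key d l i j hl
    | true => exact hback _ _ (key d _ i j (by simp [hl]))
  refine ⟨ψ, fun s x => ?_⟩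
  obtain ⟨l, i, j⟩ := x
  cases s with
  | a e => simp [ha, cocycle, pot]
  | b e => simp [hb, cocycle, pot]
  | p d => exact hEp d _
  | v d e =>
    by_cases h : coord (!d) l = e
    · subst h
      have key : ∀ l, coord d l = false → E (v d (coord (!d) l)) (l, i, j) =
          ψ (cocycle A B ρ R (v d (coord (!d) l)) (l, i, j)) := by
        intro l hl
        rw [hf d l i j hl, hψf]
        simp [cocycle, move, pot, hl]
      cases hl : coord d l with
      | false => exact key l hl
      | true =>
        apply hback
        have h := key (reflect d l) (by simp [hl])
        rw [coord_not_reflect] at h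
        simpa [move] using h
    · rw [hfix _ _ (by simp [move, h])]
      simp [cocycle, move, h]
  | t d e =>
    by_cases h : coord (!d) l = e ∧ R i d e = j
    · rw [← htor _ _ (.pt d e) (l, i, j) (by simp [move, h]), hEp]
      simp [cocycle, move, pot, h]
    · rw [hfix _ _ (by simp [move, h])]
      simp [cocycle, move, h]

end Generator

open Generator RightAngled


/-- A fixed group from which every group `G` with a suitable finite generating family is
obtained, as the quotient of a subgroup of finite index by its torsion. -/
theorem exists_finiteIndex_mulEquiv {I J G : Type} [Group G] [Finite I] [Finite J]
    (A : Zigzag J) (B : Zigzag I) (ρ : J → G) (R : I → Bool → Bool → J)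
    (hρ : ρ A.root = 1) (hρgen : Subgroup.closure (Set.range ρ) = ⊤)
    (hext : ∀ (H : Type) [Group H] (f : J → H), (∀ a b c, ρ a * ρ b = ρ c → f a * f b = f c) →
      ∃ ψ : G →* H, ∀ j, ψ (ρ j) = f j)
    (hR : ∀ i, ρ (R i true true) * ρ (R i false false) = ρ (R i false true) * ρ (R i true false))
    (hRsurj : ∀ S : Bool → Bool → J,
      ρ (S true true) * ρ (S false false) = ρ (S false true) * ρ (S true false) → ∃ i, R i = S) :
    ∃ Γ' : Subgroup (RightAngled Comm), Γ'.FiniteIndex ∧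
      Nonempty (G ≃* (Γ' ⧸ Subgroup.closure {x : Γ' | IsOfFinOrder x})) := by
  obtain ⟨act, κ, hact, hκgen, hκ, hκtor⟩ := exists_action_cocycle (r := Comm)
    (move_move A B R) (fun s s' h => move_comm A B R h) (exists_pot_of_clique A B ρ R hR)
  have hκ1 : ∀ x, κ 1 x = 1 := fun x => by simpa using hκ 1 1 x
  obtain ⟨α, hα⟩ : ∃ α : List Bool → RightAngled Comm,
      ∀ w, α w = (w.map fun e => gen Comm (a e)).prod := ⟨_, fun _ => rfl⟩
  obtain ⟨β, hβ⟩ : ∃ β : List Bool → RightAngled Comm,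
      ∀ w, β w = (w.map fun e => gen Comm (b e)).prod := ⟨_, fun _ => rfl⟩
  obtain ⟨lam, hlam⟩ : ∃ lam : Bool × Bool → RightAngled Comm,
      ∀ l, lam l = cond l.2 (gen Comm (v true l.1)) 1 * cond l.1 (gen Comm (v false false)) 1 :=
    ⟨_, fun _ => rfl⟩
  obtain ⟨θ, hθ⟩ : ∃ θ : (Bool × Bool) × I × J → RightAngled Comm,
      ∀ l i j, θ (l, i, j) = α (A.word j) * β (B.word i) * lam l :=
    ⟨fun x => α (A.word x.2.2) * β (B.word x.2.1) * lam x.1, fun _ _ _ => rfl⟩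
  have hα0 : α [] = 1 := by simp [hα]
  have hβ0 : β [] = 1 := by simp [hβ]
  have hαc : ∀ e w, α (e :: w) = gen Comm (a e) * α w := by simp [hα]
  have hβc : ∀ e w, β (e :: w) = gen Comm (b e) * β w := by simp [hβ]
  have hαact : ∀ w l i j, act (α w) (l, i, j) = (l, i, w.foldr A.move j) := by
    intro w l i j
    induction w with
    | nil => simp [hα0]
    | cons e w ih => rw [hαc, map_mul, Equiv.Perm.mul_apply, ih, hact]; rfl
  have hβact : ∀ w l i j, act (β w) (l, i, j) = (l, w.foldr B.move i, j) := by
    intro w l i j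
    induction w with
    | nil => simp [hβ0]
    | cons e w ih => rw [hβc, map_mul, Equiv.Perm.mul_apply, ih, hact]; rfl
  have hακ : ∀ w x, κ (α w) x = 1 := by
    intro w x
    induction w with
    | nil => rw [hα0, hκ1]
    | cons e w ih => rw [hαc, hκ, ih, hκgen]; simp [cocycle, pot]
  have hβκ : ∀ w x, κ (β w) x = 1 := by
    intro w x
    induction w with
    | nil => rw [hβ0, hκ1]
    | cons e w ih => rw [hβc, hκ, ih, hκgen]; simp [cocycle, pot]
  have hlamact : ∀ l i j, act (lam l) ((false, false), i, j) = (l, i, j) := by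
    rintro ⟨_ | _, _ | _⟩ i j <;> simp [hlam, hact, move, coord, reflect]
  have hlamκ : ∀ l i, κ (lam l) ((false, false), i, A.root) = 1 := by
    rintro ⟨_ | _, _ | _⟩ i <;>
      simp [hlam, hκ, hκ1, hκgen, hact, cocycle, move, pot, coord, reflect, hρ]
  have hbα : ∀ e w, gen Comm (b e) * α w = α w * gen Comm (b e) := by
    intro e w
    induction w with
    | nil => simp [hα0]
    | cons e' w ih =>
      rw [hαc, ← mul_assoc, ← (commute_gen (Comm.ab e' e)).eq, mul_assoc, ih, mul_assoc]
  have hv00 : gen Comm (v false false) = θ ((true, false), B.root, A.root) := by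
    simp [hθ, A.word_root, B.word_root, hα0, hβ0, hlam]
  have hv10 : gen Comm (v true false) = θ ((false, true), B.root, A.root) := by
    simp [hθ, A.word_root, B.word_root, hα0, hβ0, hlam]
  have hv11 : gen Comm (v true true) * θ ((true, false), B.root, A.root) =
      θ ((true, true), B.root, A.root) := by
    simp [hθ, A.word_root, B.word_root, hα0, hβ0, hlam]
  have hθ₀ : θ ((false, false), B.root, A.root) = 1 := by
    simp [hθ, A.word_root, B.word_root, hα0, hβ0, hlam]
  have hθact : ∀ x, act (θ x) ((false, false), B.root, A.root) = x := by
    rintro ⟨l, i, j⟩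
    rw [hθ, map_mul, map_mul, Equiv.Perm.mul_apply, Equiv.Perm.mul_apply, hlamact, hβact, hαact,
      A.foldr_word, B.foldr_word]
  refine exists_finiteIndex_mulEquiv_of_cocycle (closure_range_gen (r := Comm)) ?_ act
    ((false, false), B.root, A.root) κ hκ hκtor θ hθ₀ hθact ?_ ?_ ?_
  · rintro _ ⟨s, rfl⟩
    exact gen_inv s
  · rintro ⟨l, i, j⟩
    rw [hθ, hκ, hκ, hακ, hβκ, hlamκ, one_mul, one_mul]
  · rw [eq_top_iff, ← hρgen]
    refine Subgroup.closure_mono ?_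
    rintro _ ⟨j, rfl⟩
    refine ⟨gen Comm (v false false), ((false, false), B.root, j), ?_⟩
    simp [hκgen, cocycle, move, pot, coord, reflect]
  · intro Q _ E hE hEtor hEθ
    have hE1 : ∀ x, E 1 x = 1 := fun x => by simpa using hE 1 1 x
    have hinv : ∀ s x, E (gen Comm s) (move A B R s x) * E (gen Comm s) x = 1 := fun s x => by
      rw [← hact, ← hE, gen_mul_self, hE1]
    have hfix : ∀ s x, move A B R s x = x → E (gen Comm s) x = 1 := fun s x h =>
      hEtor _ _ (isOfFinOrder_gen s) (by rw [hact, h])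
    have hEs : ∀ s x y, gen Comm s * θ x = θ y → E (gen Comm s) x = 1 := fun s x y h => by
      have := hE (gen Comm s) (θ x) ((false, false), B.root, A.root)
      rwa [h, hEθ, hθact, hEθ, mul_one, eq_comm] at this
    obtain ⟨ψ, hψ⟩ := exists_hom_eq_cocycle A B ρ R (Q := Q) hρ (hext Q) hR hRsurj
      (fun s x => E (gen Comm s) x) hinv
      (fun s s' h x => by
        rw [← hact, ← hact, ← hE, ← hE, (commute_gen h).eq])
      hfix
      (fun s s' h x hx => by
        have h1 := hEtor (gen Comm s * gen Comm s') x
          ((commute_gen h).isOfFinOrder_mul (isOfFinOrder_gen s) (isOfFinOrder_gen s'))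
          (by rw [map_mul, Equiv.Perm.mul_apply, hact, hact, ← hx, move_move])
        rw [hE, hact, ← hx] at h1
        exact mul_left_cancel ((hinv s x).trans h1.symm))
      (fun e x => by
        obtain ⟨l, i, j⟩ := x
        rcases A.move_cases e j with h | h | h
        · exact hfix _ _ (by simp [move, h])
        · refine hEs _ _ (l, i, A.move e j) ?_
          simp only [hθ, h, hαc, mul_assoc]
        · refine hEs _ _ (l, i, A.move e j) ?_
          simp only [hθ, h, hαc, mul_assoc, gen_mul_gen_mul])
      (fun e x => by
        obtain ⟨l, i, j⟩ := x
        rcases B.move_cases e i with h | h | h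
        · exact hfix _ _ (by simp [move, h])
        · refine hEs _ _ (l, B.move e i, j) ?_
          rw [hθ, hθ, h, hβc, ← mul_assoc, ← mul_assoc, hbα]
          simp only [mul_assoc]
        · refine hEs _ _ (l, B.move e i, j) ?_
          rw [hθ, hθ, h, hβc, ← mul_assoc, ← mul_assoc, hbα]
          simp only [mul_assoc, gen_mul_gen_mul])
      (hEs _ _ ((true, false), B.root, A.root) (by rw [hθ₀, mul_one, hv00]))
      (hEs _ _ ((false, true), B.root, A.root) (by rw [hθ₀, mul_one, hv10]))
      (hEs _ _ ((true, true), B.root, A.root) hv11)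
    refine ⟨ψ, ?_⟩
    rintro _ ⟨s, rfl⟩ x
    rw [hκgen]
    exact hψ s x

theorem RightAngled.isFinitelyPresented {V : Type} [Finite V] (r : V → V → Prop) :
    IsFinitelyPresented (RightAngled r) := by
  have := Fintype.ofFinite V
  exact ⟨V, this, rightAngledRels r, (Set.finite_range _).union ((Set.toFinite _).image _),
    ⟨MulEquiv.refl _⟩⟩

/-- There exists a finitely presented group `Γ` such that every finitely presented group `G`
is isomorphic to `Γ'/⟨Tor Γ'⟩` for some finite-index subgroup `Γ' ≤ Γ`, where `⟨Tor Γ'⟩`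
is the subgroup of `Γ'` generated by the elements of finite order. -/
theorem all_inclusive_group_exists :
    ∃ (Γ : Type) (_ : Group Γ), IsFinitelyPresented Γ ∧
      ∀ (G : Type) (_ : Group G), IsFinitelyPresented G →
        ∃ Γ' : Subgroup Γ, Γ'.FiniteIndex ∧
          Nonempty (G ≃* (Γ' ⧸ Subgroup.closure {x : Γ' | IsOfFinOrder x})) := by
  refine ⟨RightAngled Generator.Comm, inferInstance, RightAngled.isFinitelyPresented _, ?_⟩
  intro G _ hG
  obtain ⟨n, ρ, hρ, hgen, hext⟩ := hG.exists_partialHom_extension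
  let rows : Set (Bool → Bool → Fin (n + 1)) := {S |
    ρ (S true true) * ρ (S false false) = ρ (S false true) * ρ (S true false)}
  have : Nonempty rows := ⟨⟨fun _ _ => 0, rfl⟩⟩
  obtain ⟨m, ⟨e⟩⟩ := Finite.exists_equiv_fin rows
  cases m with
  | zero => exact (e (Classical.arbitrary rows)).elim0
  | succ m =>
    exact exists_finiteIndex_mulEquiv (Zigzag.fin n) (Zigzag.fin m) ρ (fun i => (e.symm i).1)
      hρ hgen hext (fun i => (e.symm i).2) fun S hS => ⟨e ⟨S, hS⟩, by simp⟩
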